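/- Let h₁, ..., hₙ ∈ ℤ[X] satisfy gcd(h₁,...,hₙ) = 1 and suppose hᵢ(0) > 0 and h_j(0) < 0 for some indices i, j. Then f₁h₁ + ⋯ + fₙhₙ = 0 has a solution over nonzero polynomials with ℕ-coefficients if and only if there is no t ≥ 0 such that h₁(t), ..., hₙ(t) are all non-negative or all non-positive. -/

import Mathlib

open Polynomial

/-- All coefficients of `p` are non-negative. -/
def CoeffNonneg {R : Type*} [Semiring R] [PartialOrder R] (p : R[X]) : Prop :=
  ∀ m : ℕ, 0 ≤ p.coeff m

namespace CoeffNonneg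

variable {R : Type*} [Semiring R] [PartialOrder R] [IsOrderedRing R]

theorem add {p q : R[X]} (hp : CoeffNonneg p) (hq : CoeffNonneg q) : CoeffNonneg (p + q) :=
  fun m => by simpa using add_nonneg (hp m) (hq m)

theorem mul {p q : R[X]} (hp : CoeffNonneg p) (hq : CoeffNonneg q) : CoeffNonneg (p * q) :=
  fun m => by
    rw [coeff_mul]
    exact Finset.sum_nonneg fun x _ => mul_nonneg (hp _) (hq _)

theorem one : CoeffNonneg (1 : R[X]) := fun m => by
  rw [coeff_one]
  split_ifs <;> simp

theorem pow {p : R[X]} (hp : CoeffNonneg p) (k : ℕ) : CoeffNonneg (p ^ k) := by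
  induction k with
  | zero => simpa using one
  | succ k ih => simpa [pow_succ] using ih.mul hp

theorem one_add_X : CoeffNonneg (1 + X : R[X]) :=
  one.add fun m => by
    rw [coeff_X]
    split_ifs <;> simp

theorem aeval_nonneg {p : ℤ[X]} (hp : CoeffNonneg p) {t : ℝ} (ht : 0 ≤ t) : 0 ≤ aeval t p := by
  rw [aeval_eq_sum_range]
  exact Finset.sum_nonneg fun m _ => by
    rw [zsmul_eq_mul]
    exact mul_nonneg (mod_cast hp m) (pow_nonneg ht m)

theorem aeval_pos {p : ℤ[X]} (hp : CoeffNonneg p) (h0 : p ≠ 0) {t : ℝ} (ht : 0 < t) :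
    0 < aeval t p := by
  rw [aeval_eq_sum_range]
  refine Finset.sum_pos' (fun m _ => ?_) ⟨p.natDegree, by simp, ?_⟩
  · rw [zsmul_eq_mul]
    exact mul_nonneg (mod_cast hp m) (pow_nonneg ht.le m)
  · rw [zsmul_eq_mul]
    refine mul_pos ?_ (pow_pos ht _)
    exact_mod_cast lt_of_le_of_ne (hp _) (Ne.symm (leadingCoeff_ne_zero.mpr h0))

end CoeffNonneg

theorem exists_nonunit_dvd_of_common_root {ι : Type*} (h : ι → ℤ[X]) {i₀ : ι} (hi₀ : h i₀ ≠ 0)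
    {t : ℝ} (ht : ∀ i, aeval t (h i) = 0) : ∃ q : ℤ[X], ¬ IsUnit q ∧ ∀ i, q ∣ h i := by
  have halg : IsAlgebraic ℤ t := ⟨h i₀, hi₀, ht i₀⟩
  have hint : IsIntegral ℚ t :=
    ((IsFractionRing.isAlgebraic_iff ℤ ℚ ℝ).1 halg).isIntegral
  refine ⟨(IsLocalization.integerNormalization (nonZeroDivisors ℤ) (minpoly ℚ t)).primPart,
    fun hu => minpoly.not_isUnit ℚ t
      (isUnit_or_eq_zero_of_isUnit_integerNormalization_primPart (minpoly.ne_zero hint) hu),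
    fun i => (isPrimitive_primPart _).dvd_of_fraction_map_dvd_fraction_map (K := ℚ) ?_⟩
  obtain ⟨b, hb, hbq⟩ := IsLocalization.integerNormalization_spec (nonZeroDivisors ℤ) (minpoly ℚ t)
  refine (Polynomial.map_dvd (algebraMap ℤ ℚ) (primPart_dvd _)).trans ?_
  rw [hbq]
  have hb0 : (b : ℚ) ≠ 0 := by exact_mod_cast nonZeroDivisors.ne_zero hb
  have hassoc : b • minpoly ℚ t = C (b : ℚ) * minpoly ℚ t := by
    ext m
    simp
  rw [hassoc, (isUnit_C.2 hb0.isUnit).mul_left_dvd]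
  refine minpoly.dvd ℚ t ?_
  rw [aeval_map_algebraMap, ht i]

theorem cast_choose_mul_add_one (n k : ℕ) :
    (n.choose k : ℝ) * (n + 1) = (n + 1).choose k * (n + 1 - k) := by
  rcases le_or_gt k (n + 1) with hk | hk
  · have := Nat.choose_mul_succ_eq n k
    have h2 : ((n + 1 - k : ℕ) : ℝ) = n + 1 - k := by
      rw [Nat.cast_sub hk]
      simp
    rw [← h2]
    exact_mod_cast this
  · rw [Nat.choose_eq_zero_of_lt hk, Nat.choose_eq_zero_of_lt (by omega)]
    simp

theorem cast_add_one_mul_choose (n k : ℕ) :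
    (n.choose k : ℝ) * (n + 1) = (n + 1).choose (k + 1) * (k + 1) := by
  have := Nat.add_one_mul_choose_eq n k
  rw [mul_comm]
  exact_mod_cast this

theorem coeff_one_add_X_pow_mul_quadratic (a b c : ℝ) (N m : ℕ) :
    ((N : ℝ) + 1) * (N + 2) * ((1 + X) ^ N * (C a * X ^ 2 + C b * X + C c)).coeff m =
      (N + 2).choose m *
        (a * (m * (m - 1)) + b * (m * (N + 2 - m)) + c * ((N + 2 - m) * (N + 1 - m))) := by
  have hexp : (1 + X : ℝ[X]) ^ N * (C a * X ^ 2 + C b * X + C c) =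
      C a * ((1 + X) ^ N * X ^ 2) + C b * ((1 + X) ^ N * X) + C c * (1 + X) ^ N := by ring
  rw [hexp]
  simp only [coeff_add, coeff_C_mul]
  have key : ∀ k : ℕ, (N.choose k : ℝ) * (N + 1) * (N + 2) =
      (N + 2).choose k * ((N + 2 - k) * (N + 1 - k)) := fun k => by
    have h1 := cast_choose_mul_add_one N k
    have h2 := cast_choose_mul_add_one (N + 1) k
    push_cast at h2
    rw [h1]
    linear_combination ((N : ℝ) + 1 - k) * h2
  rcases m with _ | _ | m
  · have := key 0
    simp only [coeff_one_add_X_pow, coeff_mul_X_pow', coeff_mul_X_zero]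
    simp at this ⊢
    ring
  · have h0 := key 1
    simp only [coeff_one_add_X_pow, coeff_mul_X_pow', zero_add, coeff_mul_X] at *
    simp at h0 ⊢
    linear_combination c * h0
  · have h0 := key (m + 2)
    have h1 := cast_add_one_mul_choose N (m + 1)
    have h2 := cast_choose_mul_add_one (N + 1) (m + 2)
    have h3 := cast_add_one_mul_choose N m
    have h4 := cast_add_one_mul_choose (N + 1) (m + 1)
    simp only [coeff_one_add_X_pow, coeff_mul_X_pow, show m + 1 + 1 = m + 2 from rfl]
    rw [show m + 2 = (m + 1) + 1 from rfl, coeff_mul_X, coeff_one_add_X_pow]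
    simp only [show m + 1 + 1 = m + 2 from rfl, show N + 1 + 1 = N + 2 from rfl] at *
    push_cast at *
    linear_combination c * h0 + b * (N + 2) * h1 + b * (m + 2) * h2 + a * (N + 2) * h3
      + a * (m + 1) * h4

theorem exists_coeffNonneg_one_add_X_pow_mul_quadratic {a b c : ℝ} (ha : 0 < a)
    (hd : b ^ 2 < 4 * a * c) :
    ∃ N : ℕ, CoeffNonneg ((1 + X) ^ N * (C a * X ^ 2 + C b * X + C c)) := by
  have hc : 0 < c := by
    by_contra! hc
    nlinarith [sq_nonneg b]
  obtain ⟨e, he, hea, hec⟩ : ∃ e : ℝ, 0 < e ∧ e * (4 * a) ≤ 4 * a * c - b ^ 2 ∧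
      e * (4 * c) ≤ 4 * a * c - b ^ 2 := by
    refine ⟨(4 * a * c - b ^ 2) / (4 * (a + c)), by have := sub_pos.2 hd; positivity, ?_, ?_⟩ <;>
    · rw [div_mul_eq_mul_div, div_le_iff₀ (by positivity)]
      nlinarith
  obtain ⟨N, hN⟩ := exists_nat_ge (4 * (a + c) / e)
  rw [div_le_iff₀ he] at hN
  refine ⟨N, fun m => ?_⟩
  rcases le_or_gt m (N + 2) with hm | hm
  swap
  · have := coeff_one_add_X_pow_mul_quadratic a b c N m
    rw [Nat.choose_eq_zero_of_lt hm, Nat.cast_zero, zero_mul] at this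
    exact ((mul_eq_zero.1 this).resolve_left (by positivity)).ge
  refine (mul_nonneg_iff_of_pos_left (c := ((N : ℝ) + 1) * (N + 2)) (by positivity)).1 ?_
  rw [coeff_one_add_X_pow_mul_quadratic]
  refine mul_nonneg (Nat.cast_nonneg _) ?_
  obtain ⟨M, hM⟩ : ∃ M, N + 2 = m + M := ⟨N + 2 - m, by omega⟩
  have hM' : (N : ℝ) = m + M - 2 := by
    have : (N : ℝ) + 2 = m + M := by exact_mod_cast hM
    linarith
  rw [hM'] at hN ⊢
  have hm0 : (0 : ℝ) ≤ m := by positivity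
  have hM0 : (0 : ℝ) ≤ M := by positivity
  generalize (m : ℝ) = x at *
  generalize (M : ℝ) = y at *
  have h1 : e * y ^ 2 ≤ a * x ^ 2 + b * x * y + c * y ^ 2 := by
    refine le_of_mul_le_mul_left (a := 4 * a) ?_ (by positivity)
    nlinarith [sq_nonneg (2 * a * x + b * y), mul_le_mul_of_nonneg_right hea (sq_nonneg y)]
  have h2 : e * x ^ 2 ≤ a * x ^ 2 + b * x * y + c * y ^ 2 := by
    refine le_of_mul_le_mul_left (a := 4 * c) ?_ (by positivity)
    nlinarith [sq_nonneg (2 * c * y + b * x), mul_le_mul_of_nonneg_right hec (sq_nonneg x)]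
  have h3 : 4 * (a + c) * (x + y) ≤ e * (x + y) * (x + y) :=
    mul_le_mul_of_nonneg_right (by nlinarith) (by positivity)
  have h4 : e * (x + y) * (x + y) ≤ 2 * (e * x ^ 2 + e * y ^ 2) := by
    nlinarith [mul_nonneg he.le (sq_nonneg (x - y))]
  nlinarith [mul_nonneg ha.le hM0, mul_nonneg hc.le hm0]

theorem exists_coeffNonneg_of_irreducible {p : ℝ[X]} (hp : Irreducible p)
    (hroot : ∀ t : ℝ, 0 ≤ t → p.eval t ≠ 0) :
    ∃ N : ℕ, CoeffNonneg ((1 + X) ^ N * p) ∨ CoeffNonneg (-((1 + X) ^ N * p)) := by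
  have hquad := eq_quadratic_of_degree_le_two hp.degree_le_two
  set a := p.coeff 2
  set b := p.coeff 1
  set c := p.coeff 0
  by_cases ha : a = 0
  · have hlin : p = C b * X + C c := by simpa [ha] using hquad
    have hbc : 0 ≤ b * c := by
      by_contra! hneg
      have hb : b ≠ 0 := by rintro hb; simp [hb] at hneg
      refine hroot (-c / b) ?_ ?_
      · rw [← mul_div_mul_right _ _ hb]
        exact div_nonneg (by linarith) (mul_self_nonneg b)
      · rw [hlin]
        simp
        field_simp
        ring
    refine ⟨0, ?_⟩
    rw [pow_zero, one_mul]
    rcases mul_nonneg_iff.1 hbc with ⟨hb, hc⟩ | ⟨hb, hc⟩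
    · left
      rw [hlin]
      intro m
      rcases m with _ | _ | m <;> simp [coeff_X, coeff_C, hb, hc]
    · right
      rw [hlin]
      intro m
      rcases m with _ | _ | m <;> simp [coeff_X, coeff_C]
      · exact hc
      · exact hb
  · have hd : b ^ 2 < 4 * a * c := by
      by_contra! hd
      have hs : discrim a b c = √(discrim a b c) * √(discrim a b c) := by
        rw [Real.mul_self_sqrt]
        unfold discrim
        linarith
      obtain ⟨x, hx⟩ := exists_quadratic_eq_zero ha ⟨_, hs⟩
      have hx' : p.IsRoot x := by
        rw [IsRoot, hquad]
        simp
        linarith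
      have hdeg : p.natDegree = 1 :=
        natDegree_eq_of_degree_eq_some (degree_eq_one_of_irreducible_of_root hp hx')
      exact ha (coeff_eq_zero_of_natDegree_lt (by omega))
    rcases lt_or_gt_of_ne ha with ha | ha
    · obtain ⟨N, hN⟩ := exists_coeffNonneg_one_add_X_pow_mul_quadratic (a := -a) (b := -b)
        (c := -c) (by linarith) (by linarith)
      refine ⟨N, Or.inr ?_⟩
      convert hN using 1
      rw [hquad]
      simp only [C_neg]
      ring
    · obtain ⟨N, hN⟩ := exists_coeffNonneg_one_add_X_pow_mul_quadratic ha hd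
      exact ⟨N, Or.inl (by rw [hquad]; exact hN)⟩

theorem exists_coeffNonneg_one_add_X_pow_mul_or_neg (p : ℝ[X])
    (hroot : ∀ t : ℝ, 0 ≤ t → p.eval t ≠ 0) :
    ∃ N : ℕ, CoeffNonneg ((1 + X) ^ N * p) ∨ CoeffNonneg (-((1 + X) ^ N * p)) := by
  induction p using WfDvdMonoid.induction_on_irreducible with
  | zero => exact absurd eval_zero (hroot 0 le_rfl)
  | unit u hu =>
    obtain ⟨r, -, rfl⟩ := isUnit_iff.1 hu
    refine ⟨0, ?_⟩
    rw [pow_zero, one_mul]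
    rcases le_total 0 r with hr | hr
    · left
      intro m
      rw [coeff_C]
      split_ifs <;> simp [hr]
    · right
      intro m
      rw [coeff_neg, coeff_C]
      split_ifs <;> simp [hr]
  | mul a q _ hq ih =>
    obtain ⟨N, hN⟩ := ih fun t ht h0 => hroot t ht (by simp [h0])
    obtain ⟨M, hM⟩ := exists_coeffNonneg_of_irreducible hq
      fun t ht h0 => hroot t ht (by simp [h0])
    have hmul : (1 + X) ^ (M + N) * (q * a) = (1 + X) ^ M * q * ((1 + X) ^ N * a) := by ring
    refine ⟨M + N, ?_⟩
    rw [hmul]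
    rcases hM with hM | hM <;> rcases hN with hN | hN
    · exact Or.inl (hM.mul hN)
    · exact Or.inr (by simpa using hM.mul hN)
    · exact Or.inr (by simpa using hM.mul hN)
    · exact Or.inl (by simpa using hM.mul hN)

/-- **Poincaré's theorem**, the univariate case of Pólya's Positivstellensatz. -/
theorem exists_coeffNonneg_one_add_X_pow_mul (p : ℤ[X])
    (hpos : ∀ t : ℝ, 0 ≤ t → 0 < aeval t p) :
    ∃ N : ℕ, CoeffNonneg ((1 + X) ^ N * p) := by
  obtain ⟨N, hN⟩ := exists_coeffNonneg_one_add_X_pow_mul_or_neg (p.map (Int.castRingHom ℝ))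
    fun t ht => by
      have := hpos t ht
      rw [aeval_def, eval₂_eq_eval_map] at this
      exact this.ne'
  have hmap : (1 + X) ^ N * p.map (Int.castRingHom ℝ) =
      ((1 + X) ^ N * p).map (Int.castRingHom ℝ) := by simp
  rw [hmap] at hN
  refine ⟨N, ?_⟩
  rcases hN with hN | hN
  · intro m
    have := hN m
    rw [coeff_map, eq_intCast] at this
    exact_mod_cast this
  · have hneg : CoeffNonneg (-((1 + X) ^ N * p)) := fun m => by
      have := hN m
      rw [coeff_neg, coeff_map, eq_intCast] at this
      rw [coeff_neg]
      exact_mod_cast this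
    have h1 := hneg.aeval_nonneg zero_le_one
    have h2 := mul_pos (pow_pos (by norm_num : (0 : ℝ) < 1 + 1) N) (hpos 1 zero_le_one)
    simp only [map_neg, map_mul, map_pow, map_add, map_one, aeval_X] at h1
    linarith

theorem eventually_aeval_nonpos_of_leadingCoeff_nonpos {p : ℤ[X]} (hp : p.leadingCoeff ≤ 0) :
    ∀ᶠ t : ℝ in Filter.atTop, aeval t p ≤ 0 := by
  have hinj : Function.Injective (Int.castRingHom ℝ) := Int.cast_injective
  rcases le_or_gt p.degree 0 with hdeg | hdeg
  · rw [eq_C_of_degree_le_zero hdeg, leadingCoeff_C] at hp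
    refine Filter.Eventually.of_forall fun t => ?_
    rw [eq_C_of_degree_le_zero hdeg, aeval_C]
    simpa using hp
  · have hlim := (p.map (Int.castRingHom ℝ)).tendsto_atBot_of_leadingCoeff_nonpos
      (by rwa [degree_map_eq_of_injective hinj])
      (by rw [leadingCoeff_map_of_injective hinj]; simpa using hp)
    filter_upwards [hlim.eventually_le_atBot 0] with t ht
    rwa [aeval_def, eval₂_eq_eval_map]

theorem exists_forall_mul_one_add_pow_le {ι : Type*} (g : ι → ℤ[X]) (D : ℕ) {i₀ : ι}
    (hdeg : (g i₀).natDegree = D) (hlead : 0 < (g i₀).leadingCoeff)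
    (hpos : ∀ t : ℝ, 0 ≤ t → ∃ i, 0 < aeval t (g i)) :
    ∃ δ : ℝ, 0 < δ ∧ ∀ t : ℝ, 0 ≤ t → ∃ i, δ * (1 + t) ^ D ≤ aeval t (g i) := by
  have hev : ∀ᶠ t : ℝ in Filter.atTop, 2⁻¹ * (1 + t) ^ D ≤ aeval t (g i₀) := by
    have hdegX : ((1 + X : ℤ[X]) ^ D).natDegree = D := by
      rw [add_comm, ← C_1, (monic_X_add_C 1).natDegree_pow, natDegree_X_add_C, mul_one]
    have h1 : ((1 + X) ^ D - 2 * g i₀).leadingCoeff ≤ 0 := by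
      have hle : ((1 + X) ^ D - 2 * g i₀).natDegree ≤ D := by
        refine (natDegree_sub_le _ _).trans (max_le hdegX.le ?_)
        exact (natDegree_C_mul_le 2 _).trans hdeg.le
      have hcoeff : ((1 + X) ^ D - 2 * g i₀).coeff D = 1 - 2 * (g i₀).leadingCoeff := by
        rw [coeff_sub, show (2 : ℤ[X]) = C 2 from rfl, coeff_C_mul, leadingCoeff, hdeg]
        congr 1
        rw [coeff_one_add_X_pow]
        simp
      have hDeq : ((1 + X) ^ D - 2 * g i₀).natDegree = D :=
        hle.antisymm (le_natDegree_of_ne_zero (by omega))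
      rw [leadingCoeff, hDeq, hcoeff]
      omega
    filter_upwards [eventually_aeval_nonpos_of_leadingCoeff_nonpos h1] with t ht
    simp only [map_sub, map_mul, map_pow, map_add, map_one, aeval_X, map_ofNat] at ht
    linarith
  obtain ⟨T, hT⟩ := Filter.eventually_atTop.1 hev
  have hcompact : ∃ δ : ℝ, 0 < δ ∧ ∀ t ∈ Set.Icc 0 T, ∃ i, δ * (1 + t) ^ D ≤ aeval t (g i) := by
    refine isCompact_Icc.induction_on
      (p := fun s => ∃ δ : ℝ, 0 < δ ∧ ∀ t ∈ s, 0 ≤ t → ∃ i, δ * (1 + t) ^ D ≤ aeval t (g i))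
      ⟨1, one_pos, by simp⟩ ?_ ?_ ?_ |>.imp fun δ hδ => ⟨hδ.1, fun t ht => hδ.2 t ht ht.1⟩
    · rintro s s' hss ⟨δ, hδ, H⟩
      exact ⟨δ, hδ, fun t ht => H t (hss ht)⟩
    · rintro s s' ⟨δ, hδ, H⟩ ⟨δ', hδ', H'⟩
      refine ⟨min δ δ', lt_min hδ hδ', fun t ht h0 => ?_⟩
      rcases ht with ht | ht
      · obtain ⟨i, hi⟩ := H t ht h0
        exact ⟨i, (mul_le_mul_of_nonneg_right (min_le_left _ _) (by positivity)).trans hi⟩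
      · obtain ⟨i, hi⟩ := H' t ht h0
        exact ⟨i, (mul_le_mul_of_nonneg_right (min_le_right _ _) (by positivity)).trans hi⟩
    · intro t ht
      obtain ⟨i, hi⟩ := hpos t ht.1
      have ht0 : 0 < (1 + t) ^ D := pow_pos (by linarith [ht.1]) D
      refine ⟨{s | aeval t (g i) / (1 + t) ^ D / 2 * (1 + s) ^ D < aeval s (g i)}, ?_,
        aeval t (g i) / (1 + t) ^ D / 2, by positivity, fun s hs _ => ⟨i, le_of_lt hs⟩⟩
      refine mem_nhdsWithin_of_mem_nhds ((isOpen_lt (by fun_prop) (by fun_prop)).mem_nhds ?_)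
      rw [Set.mem_ofPred_eq, div_right_comm, div_mul_cancel₀ _ ht0.ne']
      linarith
  obtain ⟨δ, hδ, H⟩ := hcompact
  refine ⟨min δ 2⁻¹, lt_min hδ (by norm_num), fun t ht => ?_⟩
  have ht0 : 0 ≤ (1 + t) ^ D := by positivity
  rcases le_total t T with htT | htT
  · obtain ⟨i, hi⟩ := H t ⟨ht, htT⟩
    exact ⟨i, (mul_le_mul_of_nonneg_right (min_le_left _ _) ht0).trans hi⟩
  · exact ⟨i₀, (mul_le_mul_of_nonneg_right (min_le_right _ _) ht0).trans (hT t htT)⟩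

theorem exists_forall_abs_coeff_lt {ι : Type*} [Fintype ι] (g : ι → ℤ[X]) :
    ∃ A : ℤ, 0 < A ∧ ∀ i m, |(g i).coeff m| < A := by
  refine ⟨∑ i, ∑ m ∈ (g i).support, |(g i).coeff m| + 1, ?_, fun i m => Int.lt_add_one_iff.2 ?_⟩
  · exact Int.lt_add_one_iff.2
      (Finset.sum_nonneg fun i _ => Finset.sum_nonneg fun m _ => abs_nonneg _)
  · refine le_trans ?_ (Finset.single_le_sum (f := fun i => ∑ m ∈ (g i).support, |(g i).coeff m|)
      (fun i _ => Finset.sum_nonneg fun m _ => abs_nonneg _) (Finset.mem_univ i))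
    by_cases hm : m ∈ (g i).support
    · exact Finset.single_le_sum (f := fun m => |(g i).coeff m|) (fun _ _ => abs_nonneg _) hm
    · rw [notMem_support_iff.1 hm, abs_zero]
      exact Finset.sum_nonneg fun m _ => abs_nonneg _

theorem neg_mul_pow_le_mul_add_pow {b x : ℝ} (hb : 0 ≤ b) (hx : -b ≤ x) (K : ℕ) :
    -(b * b ^ K) ≤ x * (b + x) ^ K := by
  have hbx : 0 ≤ b + x := by linarith
  rcases le_total 0 x with h0 | h0
  · exact (neg_nonpos.2 (by positivity)).trans (by positivity)
  · have : (b + x) ^ K ≤ b ^ K := pow_le_pow_left₀ hbx (by linarith) K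
    nlinarith [mul_le_mul (show -x ≤ b by linarith) this (by positivity) hb]

theorem exists_pow_sum_mul_pos {ι : Type*} [Fintype ι] {δ : ℝ} (hδ : 0 < δ) :
    ∃ K : ℕ, ∀ (b : ℝ) (x : ι → ℝ), 0 < b → (∀ i, -b ≤ x i) → (∃ i, δ * b ≤ x i) →
      0 < ∑ i, x i * (b + x i) ^ K := by
  classical
  obtain ⟨K, hK⟩ := pow_unbounded_of_one_lt (Fintype.card ι / δ) (show 1 < 1 + δ by linarith)
  rw [div_lt_iff₀ hδ] at hK
  refine ⟨K, fun b x hb hx ⟨i, hi⟩ => ?_⟩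
  have hbig : (1 + δ) ^ K * δ * (b * b ^ K) ≤ x i * (b + x i) ^ K := by
    calc (1 + δ) ^ K * δ * (b * b ^ K) = δ * b * (b + δ * b) ^ K := by
          rw [show b + δ * b = (1 + δ) * b by ring, mul_pow]
          ring
      _ ≤ _ := by
          have : 0 < x i := lt_of_lt_of_le (by positivity) hi
          gcongr
  have hrest : ∑ j ∈ Finset.univ.erase i, -(b * b ^ K) ≤
      ∑ j ∈ Finset.univ.erase i, x j * (b + x j) ^ K :=
    Finset.sum_le_sum fun j _ => neg_mul_pow_le_mul_add_pow hb.le (hx j) K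
  rw [← Finset.add_sum_erase _ _ (Finset.mem_univ i)]
  rw [Finset.sum_const, nsmul_eq_mul] at hrest
  have hcard : ((Finset.univ.erase i).card : ℝ) ≤ Fintype.card ι := by
    exact_mod_cast Finset.card_le_univ _
  have hb' : 0 < b * b ^ K := by positivity
  nlinarith [mul_le_mul_of_nonneg_right hcard hb'.le, mul_lt_mul_of_pos_right hK hb']

theorem exists_coeffNonneg_combination_of_natDegree_le {ι : Type*} [Fintype ι] (g : ι → ℤ[X])
    (D : ℕ) (hle : ∀ i, (g i).natDegree ≤ D) {i₀ : ι}
    (hdeg : (g i₀).natDegree = D) (hlead : 0 < (g i₀).leadingCoeff)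
    (hpos : ∀ t : ℝ, 0 ≤ t → ∃ i, 0 < aeval t (g i)) :
    ∃ f : ι → ℤ[X], (∀ i, f i ≠ 0 ∧ CoeffNonneg (f i)) ∧
      ∑ i, f i * g i ≠ 0 ∧ CoeffNonneg (∑ i, f i * g i) := by
  obtain ⟨δ, hδ, H⟩ := exists_forall_mul_one_add_pow_le g D hdeg hlead hpos
  obtain ⟨A, hA0, hA⟩ := exists_forall_abs_coeff_lt g
  have hA0' : (0 : ℝ) < A := by exact_mod_cast hA0
  obtain ⟨K, hK⟩ := exists_pow_sum_mul_pos (ι := ι) (div_pos hδ hA0')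
  have hnonneg : ∀ i, CoeffNonneg (C A * (1 + X) ^ D + g i) := fun i m => by
    rw [coeff_add, coeff_C_mul, coeff_one_add_X_pow]
    rcases le_or_gt m D with hm | hm
    · have h1 : (1 : ℤ) ≤ D.choose m := by exact_mod_cast Nat.choose_pos hm
      have h2 := abs_lt.1 (hA i m)
      nlinarith
    · rw [coeff_eq_zero_of_natDegree_lt ((hle i).trans_lt hm)]
      positivity
  have hne : ∀ i, C A * (1 + X) ^ D + g i ≠ 0 := fun i h0 => by
    have h1 := congrArg (fun p => coeff p 0) h0
    have h2 := abs_lt.1 (hA i 0)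
    simp only [coeff_add, coeff_C_mul, coeff_one_add_X_pow, Nat.choose_zero_right, coeff_zero,
      Nat.cast_one, mul_one] at h1
    linarith
  have hval : ∀ (t : ℝ) i, aeval t (C A * (1 + X) ^ D + g i) = A * (1 + t) ^ D + aeval t (g i) :=
    fun t i => by simp
  set p : ℤ[X] := ∑ i, (C A * (1 + X) ^ D + g i) ^ K * g i with hp
  have hppos : ∀ t : ℝ, 0 ≤ t → 0 < aeval t p := fun t ht => by
    have := hK (A * (1 + t) ^ D) (fun i => aeval t (g i)) (by positivity)
      (fun i => by
        have := (hnonneg i).aeval_nonneg ht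
        rw [hval] at this
        linarith)
      ((H t ht).imp fun i hi => by rwa [← mul_assoc, div_mul_cancel₀ _ hA0'.ne'])
    rw [hp, map_sum]
    refine this.trans_eq (Finset.sum_congr rfl fun i _ => ?_)
    rw [map_mul, map_pow, hval, mul_comm]
  obtain ⟨N, hN⟩ := exists_coeffNonneg_one_add_X_pow_mul p hppos
  have hX : (1 + X : ℤ[X]) ≠ 0 := by
    rw [add_comm]
    exact X_add_C_ne_zero 1
  have hsum : ∑ i, (1 + X) ^ N * (C A * (1 + X) ^ D + g i) ^ K * g i = (1 + X) ^ N * p := by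
    rw [hp, Finset.mul_sum]
    exact Finset.sum_congr rfl fun i _ => by ring
  refine ⟨fun i => (1 + X) ^ N * (C A * (1 + X) ^ D + g i) ^ K, fun i =>
    ⟨mul_ne_zero (pow_ne_zero _ hX) (pow_ne_zero _ (hne i)),
      (CoeffNonneg.one_add_X.pow N).mul ((hnonneg i).pow K)⟩, ?_, ?_⟩
  · rw [hsum]
    refine mul_ne_zero (pow_ne_zero _ hX) fun h0 => ?_
    simpa [h0] using hppos 0 le_rfl
  · rwa [hsum]

theorem exists_coeffNonneg_combination {ι : Type*} [Fintype ι] (h : ι → ℤ[X])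
    (hpos : ∀ t : ℝ, 0 ≤ t → ∃ i, 0 < aeval t (h i)) :
    ∃ f : ι → ℤ[X], (∀ i, f i ≠ 0 ∧ CoeffNonneg (f i)) ∧
      ∑ i, f i * h i ≠ 0 ∧ CoeffNonneg (∑ i, f i * h i) := by
  obtain ⟨i₀, hi₀⟩ : ∃ i, 0 < (h i).leadingCoeff := by
    by_contra! hneg
    obtain ⟨t, ht, ht0⟩ := ((Filter.eventually_all.2 fun i =>
      eventually_aeval_nonpos_of_leadingCoeff_nonpos (hneg i)).and
        (Filter.eventually_ge_atTop (0 : ℝ))).exists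
    obtain ⟨i, hi⟩ := hpos t ht0
    exact (ht i).not_gt hi
  have hmon : (1 + X : ℤ[X]).Monic := by
    rw [add_comm]
    exact monic_X_add_C 1
  have hdegX : (1 + X : ℤ[X]).natDegree = 1 := by
    rw [add_comm]
    exact natDegree_X_add_C 1
  set D := Finset.univ.sup fun i => (h i).natDegree
  have hD : ∀ i, (h i).natDegree ≤ D := fun i =>
    Finset.le_sup (f := fun i => (h i).natDegree) (Finset.mem_univ i)
  have hdeg : ∀ i, h i ≠ 0 →
      ((1 + X) ^ (D - (h i).natDegree) * h i).natDegree = D := fun i hi => by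
    rw [(hmon.pow _).natDegree_mul' hi, hmon.natDegree_pow, hdegX, mul_one,
      Nat.sub_add_cancel (hD i)]
  obtain ⟨f, hf, hsum, hsum'⟩ := exists_coeffNonneg_combination_of_natDegree_le
    (fun i => (1 + X) ^ (D - (h i).natDegree) * h i) D
    (fun i => by
      by_cases hi : h i = 0
      · simp [hi]
      · exact (hdeg i hi).le)
    (hdeg i₀ (leadingCoeff_ne_zero.1 hi₀.ne'))
    (by rwa [leadingCoeff_monic_mul (hmon.pow _)])
    (fun t ht => (hpos t ht).imp fun i hi => by
      rw [map_mul, map_pow, map_add, map_one, aeval_X]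
      positivity)
  simp only [← mul_assoc] at hsum hsum'
  exact ⟨fun i => f i * (1 + X) ^ (D - (h i).natDegree), fun i =>
    ⟨mul_ne_zero (hf i).1 (pow_ne_zero _ hmon.ne_zero),
      (hf i).2.mul (CoeffNonneg.one_add_X.pow _)⟩, hsum, hsum'⟩

theorem aeval_eq_zero_of_combination_eq_zero {ι : Type*} [Fintype ι] {f h : ι → ℤ[X]}
    (hf0 : ∀ i, f i ≠ 0) (hf : ∀ i, CoeffNonneg (f i)) (hsum : ∑ i, f i * h i = 0)
    {t : ℝ} (ht : 0 < t) (hh : ∀ i, 0 ≤ aeval t (h i)) (i : ι) : aeval t (h i) = 0 := by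
  have h1 : ∑ i, aeval t (f i) * aeval t (h i) = 0 := by
    simpa using congrArg (aeval t) hsum
  have h2 := (Finset.sum_eq_zero_iff_of_nonneg fun i _ =>
    mul_nonneg ((hf i).aeval_nonneg ht.le) (hh i)).1 h1 i (Finset.mem_univ i)
  exact (mul_eq_zero.1 h2).resolve_left ((hf i).aeval_pos (hf0 i) ht).ne'

theorem stmt9 (n : ℕ) (h : Fin n → Polynomial ℤ)
    (hgcd : Finset.univ.gcd h = 1)
    (hi : ∃ i, 0 < (h i).eval 0) (hj : ∃ j, (h j).eval 0 < 0) :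
    (∃ f : Fin n → Polynomial ℤ,
      (∀ i, f i ≠ 0) ∧ (∀ i, ∀ m : ℕ, 0 ≤ (f i).coeff m) ∧ ∑ i, f i * h i = 0) ↔
    ¬ ∃ t : ℝ, 0 ≤ t ∧
      ((∀ i, 0 ≤ aeval t (h i)) ∨ (∀ i, aeval t (h i) ≤ 0)) := by
  constructor
  · rintro ⟨f, hf0, hf, hsum⟩ ⟨t, ht, hsign⟩
    have hzero : ∀ i, aeval (0 : ℝ) (h i) = ((h i).eval 0 : ℤ) := fun i => by
      rw [← coeff_zero_eq_aeval_zero', coeff_zero_eq_eval_zero, algebraMap_int_eq, eq_intCast]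
    obtain ⟨i₀, hi₀⟩ := hi
    obtain ⟨j₀, hj₀⟩ := hj
    rcases ht.eq_or_lt with rfl | ht
    · simp only [hzero, Int.cast_nonneg_iff, Int.cast_nonpos] at hsign
      rcases hsign with hs | hs
      · exact (hs j₀).not_gt hj₀
      · exact (hs i₀).not_gt hi₀
    · have hroot : ∀ i, aeval t (h i) = 0 := by
        rcases hsign with hs | hs
        · exact aeval_eq_zero_of_combination_eq_zero hf0 hf hsum ht hs
        · intro i
          have := aeval_eq_zero_of_combination_eq_zero (h := fun i => -h i) hf0 hf
            (by simp [hsum]) ht (fun i => by simpa using hs i) i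
          simpa using this
      obtain ⟨q, hq, hdvd⟩ := exists_nonunit_dvd_of_common_root h (i₀ := i₀)
        (by rintro h0; simp [h0] at hi₀) hroot
      exact hq (isUnit_of_dvd_one (hgcd ▸ Finset.dvd_gcd fun i _ => hdvd i))
  · intro hno
    push Not at hno
    obtain ⟨f, hf, hp0, hp⟩ := exists_coeffNonneg_combination h fun t ht => (hno t ht).2
    obtain ⟨k, hk, hq0, hq⟩ := exists_coeffNonneg_combination (fun i => -h i) fun t ht =>
      (hno t ht).1.imp fun i hi => by simpa using hi
    set p := ∑ i, f i * h i with hpdef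
    set q := ∑ i, k i * -h i with hqdef
    refine ⟨fun i => q * f i + p * k i, fun i h0 => ?_,
      fun i => (hq.mul (hf i).2).add (hp.mul (hk i).2), ?_⟩
    · have h1 := (hq.mul (hf i).2).aeval_pos (mul_ne_zero hq0 (hf i).1) one_pos
      have h2 := (hp.mul (hk i).2).aeval_nonneg zero_le_one
      have h3 := congrArg (aeval (1 : ℝ)) h0
      rw [map_add, map_zero] at h3
      linarith
    · calc ∑ i, (q * f i + p * k i) * h i
          = q * ∑ i, f i * h i - p * ∑ i, k i * -h i := by
            rw [Finset.mul_sum, Finset.mul_sum, ← Finset.sum_sub_distrib]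
            exact Finset.sum_congr rfl fun i _ => by ring
        _ = 0 := by
            rw [← hpdef, ← hqdef]
            ring
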